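/- arXiv:0803.0783 — 6 statements merged into one kernel-verified Lean document; each statement's English description precedes it below -/
import Mathlib

section
/- Let N, M be positive integers and let a, b be integers with gcd(a,b) = 1, 0 ≤ a ≤ M, and |b| ≤ N. Then the number of distinct integers in the set { n·a + m·b : (n,m) ∈ D } equals N·a + M·|b| − a·|b|. -/
theorem reduce_aux (N M a b : ℕ) (hab : 0 < a + b) (k : ℕ) : ∀ n m : ℕ, n + (M - m) ≤ k → n < N → m < M →
    ∃ n' m' : ℕ, n' < N ∧ m' < M ∧ (n' < b ∨ M ≤ m' + a) ∧ n' * a + m' * b = n * a + m * b := by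
  induction k with
  | zero => intro n m h1 h2 h3; omega
  | succ k ih =>
    intro n m h1 h2 h3
    by_cases h : n < b ∨ M ≤ m + a
    · exact ⟨n, m, h2, h3, h, rfl⟩
    · push Not at h
      obtain ⟨n', m', p1, p2, p3, p4⟩ := ih (n - b) (m + a) (by omega) (by omega) (by omega)
      refine ⟨n', m', p1, p2, p3, p4.trans ?_⟩
      obtain ⟨c, rfl⟩ := Nat.exists_eq_add_of_le h.1
      rw [Nat.add_sub_cancel_left]
      ring

theorem inj_aux (M a b n m n' m' : ℕ) (hc : Nat.Coprime a b) (hm' : m' < M)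
    (hS : n < b ∨ M ≤ m + a) (hS' : n' < b ∨ M ≤ m' + a) (hle : m ≤ m')
    (h : n * a + m * b = n' * a + m' * b) : n = n' ∧ m = m' := by
  have hcz : IsCoprime (a : ℤ) (b : ℤ) := Nat.isCoprime_iff_coprime.mpr hc
  have hz : (n : ℤ) * a + m * b = n' * a + m' * b := by exact_mod_cast h
  have key : ∃ k : ℤ, (n : ℤ) - n' = b * k ∧ (m' : ℤ) - m = a * k := by
    obtain ⟨u, v, huv⟩ := hcz
    refine ⟨u * (m' - m) + v * (n - n'), ?_, ?_⟩
    · linear_combination (-(n : ℤ) + n') * huv + u * hz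
    · linear_combination (-(m' : ℤ) + m) * huv - v * hz
  obtain ⟨k, h1, h2⟩ := key
  rcases lt_trichotomy k 0 with hk | hk | hk
  · have : (a : ℤ) * k ≤ 0 := mul_nonpos_of_nonneg_of_nonpos (by positivity) hk.le
    have hmm : m = m' := by omega
    have ha0 : (a : ℤ) = 0 := by
      have : (a : ℤ) * k = 0 := by omega
      rcases mul_eq_zero.mp this with h | h <;> omega
    have ha0' : a = 0 := by exact_mod_cast ha0
    have hb : b = 1 := by simpa [ha0'] using hc
    subst hb
    omega
  · subst hk
    constructor <;> simp at h1 h2 <;> omega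
  · have e1 : (b : ℤ) ≤ b * k := le_mul_of_one_le_right (by positivity) hk
    have e2 : (a : ℤ) ≤ a * k := le_mul_of_one_le_right (by positivity) hk
    omega

theorem nat_aux (N M a b : ℕ) (hc : Nat.Coprime a b) (ha : a ≤ M) (hb : b ≤ N) :
    (((Finset.range N) ×ˢ (Finset.range M)).image
        (fun p : ℕ × ℕ => p.1 * a + p.2 * b)).card + (N - b) * (M - a) = N * M := by
  have hab : 0 < a + b := by
    rcases Nat.eq_zero_or_pos a with h | h
    · subst h; have : b = 1 := by simpa using hc
      omega
    · omega
  set T := (Finset.Ico b N) ×ˢ (Finset.range (M - a)) with hT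
  set D := (Finset.range N) ×ˢ (Finset.range M) with hD
  have hTD : T ⊆ D := by
    intro p hp
    simp only [hT, hD, Finset.mem_product, Finset.mem_Ico, Finset.mem_range] at *
    omega
  have hmem : ∀ p : ℕ × ℕ, p ∈ D \ T ↔ p.1 < N ∧ p.2 < M ∧ (p.1 < b ∨ M ≤ p.2 + a) := by
    intro p
    simp only [hT, hD, Finset.mem_sdiff, Finset.mem_product, Finset.mem_Ico, Finset.mem_range]
    omega
  have him : D.image (fun p : ℕ × ℕ => p.1 * a + p.2 * b)
      = (D \ T).image (fun p : ℕ × ℕ => p.1 * a + p.2 * b) := by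
    apply Finset.Subset.antisymm
    · intro x hx
      obtain ⟨p, hp, rfl⟩ := Finset.mem_image.mp hx
      simp only [hD, Finset.mem_product, Finset.mem_range] at hp
      obtain ⟨n', m', q1, q2, q3, q4⟩ := reduce_aux N M a b hab _ p.1 p.2 le_rfl hp.1 hp.2
      exact Finset.mem_image.mpr ⟨(n', m'), (hmem _).mpr ⟨q1, q2, q3⟩, q4⟩
    · exact Finset.image_subset_image Finset.sdiff_subset
  have hinj : Set.InjOn (fun p : ℕ × ℕ => p.1 * a + p.2 * b) (D \ T : Finset (ℕ × ℕ)) := by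
    rintro ⟨n, m⟩ hp ⟨n', m'⟩ hq h
    have hp' := (hmem _).mp (Finset.mem_coe.mp hp)
    have hq' := (hmem _).mp (Finset.mem_coe.mp hq)
    simp only at hp' hq' h
    rcases le_total m m' with hle | hle
    · obtain ⟨r, s⟩ := inj_aux M a b n m n' m' hc hq'.2.1 hp'.2.2 hq'.2.2 hle h
      rw [r, s]
    · obtain ⟨r, s⟩ := inj_aux M a b n' m' n m hc hp'.2.1 hq'.2.2 hp'.2.2 hle h.symm
      rw [r, s]
  rw [him, Finset.card_image_of_injOn hinj]
  have h1 := Finset.card_sdiff_add_card_eq_card hTD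
  have h2 : T.card = (N - b) * (M - a) := by simp [hT]
  have h3 : D.card = N * M := by simp [hD]
  rw [← h2, ← h3, h1]

theorem card_distinct_indices
    (N M : ℕ) (hN : 0 < N) (hM : 0 < M)
    (a b : ℤ) (hcop : IsCoprime a b)
    (ha : 0 ≤ a) (haM : a ≤ (M : ℤ)) (hbN : |b| ≤ (N : ℤ)) :
    ((((Finset.range N) ×ˢ (Finset.range M)).image
        (fun p : ℕ × ℕ => (p.1 : ℤ) * a + (p.2 : ℤ) * b)).card : ℤ) =
      (N : ℤ) * a + (M : ℤ) * |b| - a * |b| := by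
  obtain ⟨a, rfl⟩ := Int.eq_ofNat_of_zero_le ha
  obtain ⟨c, hc⟩ := Int.eq_ofNat_of_zero_le (abs_nonneg b)
  have hcc : Nat.Coprime a c := by
    rw [← Nat.isCoprime_iff_coprime, ← hc]
    rcases abs_choice b with h | h <;> rw [h]
    · exact hcop
    · exact hcop.neg_right
  rw [hc] at hbN ⊢
  have haM' : a ≤ M := by exact_mod_cast haM
  have hbN' : c ≤ N := by exact_mod_cast hbN
  have key := nat_aux N M a c hcc haM' hbN'
  have hcard : (((Finset.range N) ×ˢ (Finset.range M)).image
        (fun p : ℕ × ℕ => (p.1 : ℤ) * a + (p.2 : ℤ) * b)).card =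
      (((Finset.range N) ×ˢ (Finset.range M)).image
        (fun p : ℕ × ℕ => p.1 * a + p.2 * c)).card := by
    rcases abs_choice b with h | h
    · have hb : b = c := by rw [← hc, h]
      rw [← Finset.card_image_of_injective _ (Nat.cast_injective (R := ℤ)), Finset.image_image]
      congr 2
      funext p
      simp [hb]
    · have hb : b = -c := by rw [← hc, h]; ring
      have hi : Function.Injective (fun x : ℕ => (x : ℤ) - ((M : ℤ) - 1) * c) := by
        intro x y hxy
        simpa using hxy
      rw [← Finset.card_image_of_injective _ hi, Finset.image_image]
      congr 1
      ext x
      simp only [Finset.mem_image, Finset.mem_product, Finset.mem_range, Function.comp]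
      constructor
      · rintro ⟨⟨n, m⟩, ⟨h1, h2⟩, rfl⟩
        simp only at h1 h2
        refine ⟨(n, M - 1 - m), ⟨h1, by simp only; omega⟩, ?_⟩
        have : ((M - 1 - m : ℕ) : ℤ) = M - 1 - m := by omega
        push_cast
        rw [this, hb]; ring
      · rintro ⟨⟨n, m⟩, ⟨h1, h2⟩, rfl⟩
        simp only at h1 h2
        refine ⟨(n, M - 1 - m), ⟨h1, by simp only; omega⟩, ?_⟩
        have : ((M - 1 - m : ℕ) : ℤ) = M - 1 - m := by omega
        push_cast
        rw [this, hb]; ring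
  rw [hcard]
  have keyz := congrArg (Nat.cast (R := ℤ)) key
  push_cast [Nat.cast_sub haM', Nat.cast_sub hbN'] at keyz
  push_cast
  linear_combination keyz
end

section
/- Let N, M be positive integers and let a, b be integers with gcd(a,b) = 1, 0 ≤ a ≤ M, and |b| ≤ N. Let A be the matrix with rows indexed by ℤ and columns indexed by D whose entry at row k and column (n,m) equals 1 if n·a + m·b = k and 0 otherwise (entries in ℂ). Then the rank of A (the dimension of the span of its columns) equals N·a + M·|b| − a·|b|. -/
theorem count_nat (N M a b : ℕ) (hab : Nat.Coprime a b) (haM : a ≤ M) (hbN : b ≤ N) :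
    (((Finset.range N ×ˢ Finset.range M).image (fun p : ℕ × ℕ => p.1 * a + p.2 * b)).card : ℤ)
      = N * a + M * b - a * b := by
  classical
  set f : ℕ × ℕ → ℕ := fun p => p.1 * a + p.2 * b with hf
  set D := Finset.range N ×ˢ Finset.range M with hD
  set E := Finset.Ico b N ×ˢ Finset.range (M - a) with hE
  have hpos : 0 < a ∨ 0 < b := by
    by_contra h
    have h1 : a = 0 := by omega
    have h2 : b = 0 := by omega
    subst h1; subst h2
    simp at hab
  have hED : E ⊆ D := by
    rintro ⟨n, m⟩ h
    simp only [hE, hD, Finset.mem_product, Finset.mem_Ico, Finset.mem_range] at h ⊢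
    omega
  have himg : D.image f = (D \ E).image f := by
    apply Finset.Subset.antisymm
    · have key : ∀ k : ℕ, ∀ n m : ℕ, n + (M - m) ≤ k → (n, m) ∈ D → f (n, m) ∈ (D \ E).image f := by
        intro k
        induction k with
        | zero =>
          intro n m h hm
          simp only [hD, Finset.mem_product, Finset.mem_range] at hm
          omega
        | succ k ih =>
          intro n m h hm
          by_cases hme : (n, m) ∈ E
          · have hme' := hme
            simp only [hE, Finset.mem_product, Finset.mem_Ico, Finset.mem_range] at hme'
            have := ih (n - b) (m + a) (by omega) (by
              simp only [hD, Finset.mem_product, Finset.mem_range]; omega)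
            have e : f (n - b, m + a) = f (n, m) := by
              simp only [hf]
              obtain ⟨c, rfl⟩ := Nat.exists_eq_add_of_le hme'.1.1
              simp only [Nat.add_sub_cancel_left]
              ring
            rwa [e] at this
          · exact Finset.mem_image_of_mem _ (Finset.mem_sdiff.2 ⟨hm, hme⟩)
      intro x hx
      obtain ⟨⟨n, m⟩, hp, rfl⟩ := Finset.mem_image.1 hx
      exact key _ n m le_rfl hp
    · exact Finset.image_subset_image Finset.sdiff_subset
  have hwl : ∀ n m n' m' : ℕ, (n, m) ∈ D \ E → (n', m') ∈ D \ E → f (n, m) = f (n', m') →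
      n' ≤ n → m ≤ m' → (n, m) = (n', m') := by
    intro n m n' m' h h' e hn hm
    simp only [hD, hE, Finset.mem_sdiff, Finset.mem_product, Finset.mem_Ico,
      Finset.mem_range] at h h'
    obtain ⟨c, rfl⟩ := Nat.exists_eq_add_of_le hn
    obtain ⟨d, rfl⟩ := Nat.exists_eq_add_of_le hm
    have e2 : c * a = d * b := by simp only [hf] at e; nlinarith
    have hbc : b ∣ c := hab.symm.dvd_of_dvd_mul_right ⟨d, by rw [e2]; ring⟩
    have had : a ∣ d := hab.dvd_of_dvd_mul_right ⟨c, by rw [← e2]; ring⟩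
    by_cases hc : c = 0 ∧ d = 0
    · simp [hc.1, hc.2]
    · exfalso
      have h1 : b ≤ c := by
        rcases Nat.eq_zero_or_pos c with h0 | h0
        · subst h0
          have : d * b = 0 := by omega
          rcases Nat.mul_eq_zero.1 this with h | h <;> omega
        · exact Nat.le_of_dvd h0 hbc
      have h2 : a ≤ d := by
        rcases Nat.eq_zero_or_pos d with h0 | h0
        · subst h0
          have : c * a = 0 := by omega
          rcases Nat.mul_eq_zero.1 this with h | h <;> omega
        · exact Nat.le_of_dvd h0 had
      omega
  have hinj : Set.InjOn f (D \ E : Finset (ℕ × ℕ)) := by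
    rintro ⟨n, m⟩ h ⟨n', m'⟩ h' e
    have h := Finset.mem_coe.1 h
    have h' := Finset.mem_coe.1 h'
    have e' : n * a + m * b = n' * a + m' * b := e
    rcases le_total n' n with hn | hn <;> rcases le_total m m' with hm | hm
    · exact hwl _ _ _ _ h h' e hn hm
    · have h1 := Nat.mul_le_mul_right a hn
      have h2 := Nat.mul_le_mul_right b hm
      have h3 : n' * a = n * a := by omega
      have h4 : m' * b = m * b := by omega
      rcases hpos with hp | hp
      · have := Nat.eq_of_mul_eq_mul_right hp h3
        subst this
        exact (hwl _ _ _ _ h' h e.symm le_rfl hm).symm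
      · have := Nat.eq_of_mul_eq_mul_right hp h4
        subst this
        exact hwl _ _ _ _ h h' e hn le_rfl
    · have h1 := Nat.mul_le_mul_right a hn
      have h2 := Nat.mul_le_mul_right b hm
      have h3 : n' * a = n * a := by omega
      have h4 : m' * b = m * b := by omega
      rcases hpos with hp | hp
      · have := Nat.eq_of_mul_eq_mul_right hp h3
        subst this
        exact hwl _ _ _ _ h h' e le_rfl hm
      · have := Nat.eq_of_mul_eq_mul_right hp h4
        subst this
        exact (hwl _ _ _ _ h' h e.symm hn le_rfl).symm
    · exact (hwl _ _ _ _ h' h e.symm hn hm).symm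
  rw [himg, Finset.card_image_of_injOn hinj, Finset.card_sdiff_of_subset hED,
    Nat.cast_sub (Finset.card_le_card hED)]
  simp only [hD, hE, Finset.card_product, Finset.card_range, Nat.card_Ico]
  push_cast [haM, hbN]
  ring

theorem rank_selection_matrix
    (N M : ℕ) (hN : 0 < N) (hM : 0 < M)
    (a b : ℤ) (hcop : IsCoprime a b)
    (ha : 0 ≤ a) (haM : a ≤ (M : ℤ)) (hbN : |b| ≤ (N : ℤ))
    (A : ℤ → Fin N × Fin M → ℂ)
    (hA : ∀ (k : ℤ) (p : Fin N × Fin M),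
      A k p = if ((p.1 : ℕ) : ℤ) * a + ((p.2 : ℕ) : ℤ) * b = k then 1 else 0) :
    (Module.finrank ℂ
        ↥(Submodule.span ℂ (Set.range fun p : Fin N × Fin M => fun k : ℤ => A k p)) : ℤ) =
      (N : ℤ) * a + (M : ℤ) * |b| - a * |b| := by
  classical
  lift a to ℕ using ha
  set c := b.natAbs with hc
  have hbc : |b| = (c : ℤ) := Int.abs_eq_natAbs b
  have hcop' : Nat.Coprime a c := by
    have := Int.isCoprime_iff_gcd_eq_one.1 hcop
    simpa [Int.gcd, hc] using this
  rw [hbc] at hbN ⊢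
  have hcount := count_nat N M a c hcop' (by exact_mod_cast haM) (by exact_mod_cast hbN)
  rw [← hcount]
  set T := (Finset.range N ×ˢ Finset.range M).image (fun p : ℕ × ℕ => p.1 * a + p.2 * c) with hT
  obtain ⟨g, hg, hgT⟩ : ∃ g : ℕ → ℤ, Function.Injective g ∧
      ∀ k : ℤ, (∃ p : Fin N × Fin M, ((p.1 : ℕ) : ℤ) * a + ((p.2 : ℕ) : ℤ) * b = k) ↔
        ∃ t : T, g t = k := by
    rcases abs_choice b with h | h
    · have hb : b = c := by rw [← hbc, h]
      refine ⟨fun n => n, fun x y h => by simpa using h, fun k => ⟨?_, ?_⟩⟩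
      · rintro ⟨⟨n, m⟩, rfl⟩
        refine ⟨⟨n * a + m * c, Finset.mem_image.2 ⟨(n, m), by simp, rfl⟩⟩, ?_⟩
        rw [hb]; push_cast; rfl
      · rintro ⟨⟨t, ht⟩, rfl⟩
        obtain ⟨⟨n, m⟩, hp, rfl⟩ := Finset.mem_image.1 ht
        simp only [Finset.mem_product, Finset.mem_range] at hp
        refine ⟨(⟨n, hp.1⟩, ⟨m, hp.2⟩), ?_⟩
        rw [hb]; push_cast; rfl
    · have hb : b = -c := by rw [← hbc, h]; ring
      refine ⟨fun n => n - (M - 1) * c, fun x y h => by simpa using h, fun k => ⟨?_, ?_⟩⟩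
      · rintro ⟨⟨n, m⟩, rfl⟩
        have hm := m.2
        refine ⟨⟨n * a + (M - 1 - m : ℕ) * c,
          Finset.mem_image.2 ⟨(n, M - 1 - m), by simp; omega, rfl⟩⟩, ?_⟩
        have : ((M - 1 - m : ℕ) : ℤ) = M - 1 - m := by omega
        simp only [Nat.cast_add, Nat.cast_mul, this]
        rw [hb]; ring
      · rintro ⟨⟨t, ht⟩, rfl⟩
        obtain ⟨⟨n, m⟩, hp, rfl⟩ := Finset.mem_image.1 ht
        simp only [Finset.mem_product, Finset.mem_range] at hp
        refine ⟨(⟨n, hp.1⟩, ⟨M - 1 - m, by omega⟩), ?_⟩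
        have : ((M - 1 - m : ℕ) : ℤ) = M - 1 - m := by omega
        simp only [Nat.cast_add, Nat.cast_mul, this]
        rw [hb]; ring
  have hcol : ∀ p : Fin N × Fin M, (fun k : ℤ => A k p) =
      Pi.single (((p.1 : ℕ) : ℤ) * a + ((p.2 : ℕ) : ℤ) * b) (1 : ℂ) := by
    intro p
    ext k
    rw [hA, Pi.single_apply]
    simp only [eq_comm]
  have hrange : (Set.range fun p : Fin N × Fin M => fun k : ℤ => A k p) =
      Set.range (fun t : T => (Pi.single (g t) (1 : ℂ) : ℤ → ℂ)) := by
    ext v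
    simp only [Set.mem_range, hcol]
    constructor
    · rintro ⟨p, rfl⟩
      obtain ⟨t, ht⟩ := (hgT _).1 ⟨p, rfl⟩
      exact ⟨t, by rw [ht]⟩
    · rintro ⟨t, rfl⟩
      obtain ⟨p, hp⟩ := (hgT _).2 ⟨t, rfl⟩
      exact ⟨p, by rw [hp]⟩
  have hli : LinearIndependent ℂ (fun t : T => (Pi.single (g t) (1 : ℂ) : ℤ → ℂ)) :=
    (Pi.linearIndependent_single_one ℤ ℂ).comp (fun t : T => g t)
      (fun x y h => Subtype.ext (hg h))
  rw [hrange, finrank_span_eq_card hli, Fintype.card_coe]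
end

section
/- Let (a_1,b_1,c_1,d_1,ω_1) and (a_2,b_2,c_2,d_2,ω_2) be two evanescent-component parameter tuples and let F : ℤ² → ({1,2} × ℤ → ℂ) be their stacked column map. Then for all integers n, m, t_1, t_2: F(n,m) = exp(i ω_1 t_1)·F(n + t_1 b_1, m − t_1 a_1) + exp(i ω_2 t_2)·F(n + t_2 b_2, m − t_2 a_2) − exp(i (ω_1 t_1 + ω_2 t_2))·F(n + t_1 b_1 + t_2 b_2, m − t_1 a_1 − t_2 a_2). -/
/-- The stacked column map of `Q` evanescent-component parameter tuples
`(a_q, b_q, c_q, d_q, ω_q)`: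
`F (n,m) (q,k) = exp(i ω_q (n c_q + m d_q))` if `n a_q + m b_q = k`, and `0` otherwise. -/
noncomputable def stackedColumnMap (Q : ℕ) (a b c d : Fin Q → ℤ) (ω : Fin Q → ℝ) :
    ℤ × ℤ → Fin Q × ℤ → ℂ :=
  fun p qk =>
    if p.1 * a qk.1 + p.2 * b qk.1 = qk.2 then
      Complex.exp (Complex.I * (ω qk.1 : ℂ) *
        ((p.1 : ℂ) * (c qk.1 : ℂ) + (p.2 : ℂ) * (d qk.1 : ℂ)))
    else 0

/-- Shifting along the direction of component `q` only changes the phase. -/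
theorem stackedColumnMap_shift {Q : ℕ} (a b c d : Fin Q → ℤ) (ω : Fin Q → ℝ) (q : Fin Q)
    (hdet : a q * d q - b q * c q = 1) (n m t k : ℤ) :
    Complex.exp (Complex.I * (ω q : ℂ) * (t : ℂ)) *
      stackedColumnMap Q a b c d ω (n + t * b q, m - t * a q) (q, k) =
      stackedColumnMap Q a b c d ω (n, m) (q, k) := by
  have h : (n + t * b q) * a q + (m - t * a q) * b q = n * a q + m * b q := by ring
  have hC : (a q : ℂ) * d q - b q * c q = 1 := by exact_mod_cast hdet
  simp only [stackedColumnMap, h]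
  split_ifs
  · rw [← Complex.exp_add]
    congr 1
    push_cast
    linear_combination (-Complex.I * (ω q : ℂ) * t) * hC
  · simp

theorem stackedColumnMap_two_combination
    (a b c d : Fin 2 → ℤ) (ω : Fin 2 → ℝ)
    (ha : ∀ q, 0 ≤ a q) (hdet : ∀ q, a q * d q - b q * c q = 1) :
    ∀ n m t₁ t₂ : ℤ,
      stackedColumnMap 2 a b c d ω (n, m) =
        Complex.exp (Complex.I * (ω 0 : ℂ) * (t₁ : ℂ)) •
            stackedColumnMap 2 a b c d ω (n + t₁ * b 0, m - t₁ * a 0) +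
          Complex.exp (Complex.I * (ω 1 : ℂ) * (t₂ : ℂ)) •
            stackedColumnMap 2 a b c d ω (n + t₂ * b 1, m - t₂ * a 1) -
          Complex.exp (Complex.I * ((ω 0 : ℂ) * (t₁ : ℂ) + (ω 1 : ℂ) * (t₂ : ℂ))) •
            stackedColumnMap 2 a b c d ω
              (n + t₁ * b 0 + t₂ * b 1, m - t₁ * a 0 - t₂ * a 1) := by
  intro n m t₁ t₂
  funext ⟨q, k⟩
  simp only [Pi.add_apply, Pi.sub_apply, Pi.smul_apply, smul_eq_mul, mul_add, Complex.exp_add,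
    ← mul_assoc]
  match q with
  | 0 =>
    have h1 := stackedColumnMap_shift a b c d ω 0 (hdet 0) n m t₁ k
    have h2 := stackedColumnMap_shift a b c d ω 0 (hdet 0) (n + t₂ * b 1) (m - t₂ * a 1) t₁ k
    rw [add_right_comm, sub_right_comm] at h2
    rw [h1, mul_right_comm (Complex.exp _) (Complex.exp _), h2]
    ring
  | 1 =>
    have h1 := stackedColumnMap_shift a b c d ω 1 (hdet 1) n m t₂ k
    have h2 := stackedColumnMap_shift a b c d ω 1 (hdet 1) (n + t₁ * b 0) (m - t₁ * a 0) t₂ k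
    rw [h1, mul_assoc (Complex.exp _) (Complex.exp _), h2]
    ring
end

section
/- Let Q be a positive integer, let (a_q,b_q,c_q,d_q,ω_q), 1 ≤ q ≤ Q, be evanescent-component parameter tuples, and let F : ℤ² → ({1,…,Q} × ℤ → ℂ) be their stacked column map. Then for all integers n, m and all integers t_1, …, t_Q: F(n,m) = Σ_{S} (−1)^{|S|+1} · exp(i Σ_{q∈S} ω_q t_q) · F(n + Σ_{q∈S} t_q b_q, m − Σ_{q∈S} t_q a_q), where the outer sum ranges over all nonempty subsets S of {1, …, Q}. -/
theorem stackedColumnMap_inclusion_exclusion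
    (Q : ℕ) (hQ : 0 < Q)
    (a b c d : Fin Q → ℤ) (ω : Fin Q → ℝ)
    (ha : ∀ q, 0 ≤ a q) (hdet : ∀ q, a q * d q - b q * c q = 1) :
    ∀ (n m : ℤ) (t : Fin Q → ℤ),
      stackedColumnMap Q a b c d ω (n, m) =
        ∑ S ∈ Finset.univ.powerset.filter (fun S : Finset (Fin Q) => S.Nonempty),
          ((-1 : ℂ) ^ (S.card + 1) *
              Complex.exp (Complex.I * ((∑ q ∈ S, ω q * (t q : ℝ) : ℝ) : ℂ))) •
            stackedColumnMap Q a b c d ω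
              (n + ∑ q ∈ S, t q * b q, m - ∑ q ∈ S, t q * a q) := by
  intro n m t
  funext qk
  obtain ⟨q, k⟩ := qk
  set G : Finset (Fin Q) → ℂ := fun S =>
    (-1 : ℂ) ^ S.card *
      Complex.exp (Complex.I * ((∑ q ∈ S, ω q * (t q : ℝ) : ℝ) : ℂ)) *
      stackedColumnMap Q a b c d ω
        (n + ∑ q ∈ S, t q * b q, m - ∑ q ∈ S, t q * a q) (q, k) with hG
  -- adding `q` to `S` flips the sign of the term
  have hins : ∀ S : Finset (Fin Q), q ∉ S → G (insert q S) = - G S := by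
    intro S hq
    simp only [hG, stackedColumnMap, Finset.sum_insert hq, Finset.card_insert_of_notMem hq]
    generalize (∑ x ∈ S, t x * b x) = B
    generalize (∑ x ∈ S, t x * a x) = A
    generalize (∑ x ∈ S, ω x * (t x : ℝ)) = W
    have hc : (n + (t q * b q + B)) * a q + (m - (t q * a q + A)) * b q
        = (n + B) * a q + (m - A) * b q := by ring
    rw [hc]
    split_ifs with h
    · have hd : (a q : ℂ) * d q - b q * c q = 1 := by exact_mod_cast hdet q
      rw [pow_succ, mul_assoc ((-1 : ℂ) ^ S.card * -1), mul_assoc ((-1 : ℂ) ^ S.card),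
        mul_assoc ((-1 : ℂ) ^ S.card), ← Complex.exp_add, ← Complex.exp_add, neg_one_mul, mul_neg]
      congr 3
      push_cast
      linear_combination (-Complex.I * ω q * t q) * hd
    · simp
  have hsum : ∑ S ∈ (Finset.univ : Finset (Fin Q)).powerset, G S = 0 := by
    rw [← Finset.insert_erase (Finset.mem_univ q),
      Finset.sum_powerset_insert (Finset.notMem_erase q _), ← Finset.sum_add_distrib]
    refine Finset.sum_eq_zero fun S hS => ?_
    rw [hins S fun h => Finset.notMem_erase q _ (Finset.mem_powerset.1 hS h), add_neg_cancel]
  have hfil : Finset.univ.powerset.filter (fun S : Finset (Fin Q) => S.Nonempty)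
      = (Finset.univ : Finset (Fin Q)).powerset.erase ∅ := by
    ext S
    simp [Finset.nonempty_iff_ne_empty]
  have h0 : G ∅ = stackedColumnMap Q a b c d ω (n, m) (q, k) := by simp [hG]
  rw [← Finset.add_sum_erase _ _ (Finset.empty_mem_powerset _), h0] at hsum
  rw [hfil, Finset.sum_apply, eq_neg_of_add_eq_zero_left hsum, ← Finset.sum_neg_distrib]
  refine Finset.sum_congr rfl fun S _ => ?_
  simp only [hG, Pi.smul_apply, smul_eq_mul, pow_succ]
  ring
end

section
/- Let N, M, Q be positive integers, and let (a_q,b_q,c_q,d_q,ω_q), 1 ≤ q ≤ Q, be evanescent-component parameter tuples (no distinctness assumption). Assume Σ_{q=1}^Q a_q ≤ M and Σ_{q=1}^Q |b_q| ≤ N. Let F be the stacked column map of the Q tuples. Then the dimension over ℂ of the linear span of the family of columns { F(n,m) : (n,m) ∈ D } is at most N·Σ_{q=1}^Q a_q + M·Σ_{q=1}^Q |b_q| − (Σ_{q=1}^Q a_q)·(Σ_{q=1}^Q |b_q|). -/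
/-- The inclusion-exclusion column identity for one component. -/
lemma incl_excl_aux {Q : ℕ} (w : Fin Q → ℤ × ℤ) (l : Fin Q → ℂ) (q : Fin Q) (hl : l q ≠ 0)
    (f : ℤ × ℤ → ℂ) (hf : ∀ p, f (p + w q) = l q * f p) (p : ℤ × ℤ) :
    ∑ S ∈ (Finset.univ : Finset (Fin Q)).powerset,
      (∏ j ∈ S, (-(l j)⁻¹)) * f (p + ∑ j ∈ S, w j) = 0 := by
  rw [← Finset.insert_erase (Finset.mem_univ q),
    Finset.sum_powerset_insert (Finset.notMem_erase q _), ← Finset.sum_add_distrib]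
  refine Finset.sum_eq_zero fun t ht => ?_
  have hq : q ∉ t := fun h => Finset.notMem_erase q _ (Finset.mem_powerset.1 ht h)
  rw [Finset.prod_insert hq, Finset.sum_insert hq,
    show p + (w q + ∑ j ∈ t, w j) = (p + ∑ j ∈ t, w j) + w q by abel, hf]
  field_simp
  ring

lemma stacked_shift (Q : ℕ) (a b c d : Fin Q → ℤ) (ω : Fin Q → ℝ)
    (hdet : ∀ q, a q * d q - b q * c q = 1) (q : Fin Q) (k s : ℤ) (p : ℤ × ℤ) :
    stackedColumnMap Q a b c d ω (p + (s * b q, -(s * a q))) (q, k) =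
      Complex.exp (-(Complex.I * (ω q : ℂ) * (s : ℂ))) *
        stackedColumnMap Q a b c d ω p (q, k) := by
  have h1 : (p.1 + s * b q) * a q + (p.2 + -(s * a q)) * b q = p.1 * a q + p.2 * b q := by ring
  have h2 : (a q : ℂ) * d q - b q * c q = 1 := by exact_mod_cast hdet q
  simp only [stackedColumnMap, Prod.fst_add, Prod.snd_add, h1]
  split_ifs
  · rw [← Complex.exp_add]
    congr 1
    push_cast
    linear_combination (-(Complex.I * (ω q : ℂ) * s)) * h2
  · simp

theorem rank_stacked_components_upper_bound
    (N M Q : ℕ) (hN : 0 < N) (hM : 0 < M) (hQ : 0 < Q)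
    (a b c d : Fin Q → ℤ) (ω : Fin Q → ℝ)
    (ha : ∀ q, 0 ≤ a q) (hdet : ∀ q, a q * d q - b q * c q = 1)
    (hsum_a : (∑ q, a q) ≤ (M : ℤ)) (hsum_b : (∑ q, |b q|) ≤ (N : ℤ)) :
    (Module.finrank ℂ
        ↥(Submodule.span ℂ (stackedColumnMap Q a b c d ω ''
          {p : ℤ × ℤ | 0 ≤ p.1 ∧ p.1 < (N : ℤ) ∧ 0 ≤ p.2 ∧ p.2 < (M : ℤ)})) : ℤ) ≤
      (N : ℤ) * (∑ q, a q) + (M : ℤ) * (∑ q, |b q|) - (∑ q, a q) * (∑ q, |b q|) := by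
  classical
  set F := stackedColumnMap Q a b c d ω with hF
  set s : Fin Q → ℤ := fun q => if a q = 0 ∧ 0 < b q then -1 else 1 with hs
  set w : Fin Q → ℤ × ℤ := fun q => (s q * b q, -(s q * a q)) with hw
  set l : Fin Q → ℂ := fun q => Complex.exp (-(Complex.I * (ω q : ℂ) * (s q : ℂ))) with hl
  have hsa : ∀ q, s q * a q = a q := by
    intro q
    simp only [hs]
    split_ifs with h
    · simp [h.1]
    · simp
  have hsb : ∀ q, |s q * b q| = |b q| := by
    intro q
    simp only [hs]
    split_ifs <;> simp
  have hbN : ∀ q, |b q| ≤ N := fun q =>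
    (Finset.single_le_sum (f := fun q => |b q|) (fun i _ => abs_nonneg _)
      (Finset.mem_univ q)).trans hsum_b
  have hneg : ∀ q, s q * b q + ((N : ℤ) + 1) * (-(a q)) < 0 := by
    intro q
    have h1 := abs_le.1 (hbN q)
    by_cases h0 : a q = 0
    · have hb0 : b q ≠ 0 := by
        intro hb
        have := hdet q
        simp [h0, hb] at this
      simp only [hs, h0, true_and]
      split_ifs <;> omega
    · have : 1 ≤ a q := by have := ha q; omega
      simp only [hs, h0, false_and, if_false]
      nlinarith
  have hid : ∀ p, ∑ S ∈ (Finset.univ : Finset (Fin Q)).powerset,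
      (∏ j ∈ S, (-(l j)⁻¹)) • F (p + ∑ j ∈ S, w j) = 0 := by
    intro p
    ext ⟨q, k⟩
    have := incl_excl_aux w l q (Complex.exp_ne_zero _) (fun p => F p (q, k))
      (fun p => stacked_shift Q a b c d ω hdet q k (s q) p) p
    simpa [Finset.sum_apply] using this
  set A := ∑ q, a q with hA
  set P := ∑ q, (s q * b q)⁺ with hP
  set P' := ∑ q, (s q * b q)⁻ with hP'
  have hPP : P + P' = ∑ q, |b q| := by
    rw [hP, hP', ← Finset.sum_add_distrib]
    refine Finset.sum_congr rfl fun q _ => ?_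
    rw [posPart_add_negPart, hsb]
  have hP0 : 0 ≤ P := Finset.sum_nonneg fun q _ => posPart_nonneg _
  have hP0' : 0 ≤ P' := Finset.sum_nonneg fun q _ => negPart_nonneg _
  have hA0 : 0 ≤ A := Finset.sum_nonneg fun q _ => ha q
  set D : Finset (ℤ × ℤ) := Finset.Ico 0 (N : ℤ) ×ˢ Finset.Ico 0 (M : ℤ) with hD
  set R : Finset (ℤ × ℤ) := Finset.Ico P' (N - P) ×ˢ Finset.Ico A (M : ℤ) with hR
  have hRD : R ⊆ D := Finset.product_subset_product
    (Finset.Ico_subset_Ico hP0' (by omega)) (Finset.Ico_subset_Ico hA0 le_rfl)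
  set W := Submodule.span ℂ (((D \ R).image F : Finset _) : Set (Fin Q × ℤ → ℂ)) with hW
  have key : ∀ t : ℕ, ∀ p ∈ D, (p.1 + ((N : ℤ) + 1) * p.2).toNat = t → F p ∈ W := by
    intro t
    induction t using Nat.strong_induction_on with
    | _ t ih =>
      intro p hp ht
      by_cases hpR : p ∈ R
      swap
      · exact Submodule.subset_span (by
          simp only [Finset.coe_image]
          exact ⟨p, by simp [hp, hpR], rfl⟩)
      have h := hid p
      rw [← Finset.add_sum_erase _ _ (Finset.empty_mem_powerset _)] at h
      simp only [Finset.prod_empty, Finset.sum_empty, one_smul, add_zero] at h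
      rw [eq_neg_of_add_eq_zero_left h]
      refine W.neg_mem (W.sum_mem fun S hS => W.smul_mem _ ?_)
      have hSne : S.Nonempty := Finset.nonempty_iff_ne_empty.2 (Finset.ne_of_mem_erase hS)
      have e1 : (∑ j ∈ S, w j).1 = ∑ j ∈ S, s j * b j := by simp [hw, Prod.fst_sum]
      have e2 : (∑ j ∈ S, w j).2 = -∑ j ∈ S, a j := by
        simp [hw, Prod.snd_sum, hsa]
      have u1 : ∑ j ∈ S, s j * b j ≤ P :=
        (Finset.sum_le_sum fun j _ => le_posPart _).trans
          (Finset.sum_le_sum_of_subset_of_nonneg (Finset.subset_univ _)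
            fun j _ _ => posPart_nonneg _)
      have u2 : -P' ≤ ∑ j ∈ S, s j * b j := by
        rw [neg_le, ← Finset.sum_neg_distrib]
        exact (Finset.sum_le_sum fun j _ => neg_le_negPart _).trans
          (Finset.sum_le_sum_of_subset_of_nonneg (Finset.subset_univ _)
            fun j _ _ => negPart_nonneg _)
      have u3 : ∑ j ∈ S, a j ≤ A :=
        Finset.sum_le_sum_of_subset_of_nonneg (Finset.subset_univ _) fun j _ _ => ha j
      have u4 : 0 ≤ ∑ j ∈ S, a j := Finset.sum_nonneg fun j _ => ha j
      have u5 : ∑ j ∈ S, s j * b j + ((N : ℤ) + 1) * (-∑ j ∈ S, a j) < 0 := by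
        rw [← Finset.sum_neg_distrib, Finset.mul_sum, ← Finset.sum_add_distrib]
        exact Finset.sum_neg (fun j _ => hneg j) hSne
      have hpR' := hpR
      simp only [hR, Finset.mem_product, Finset.mem_Ico] at hpR'
      have hmem : p + ∑ j ∈ S, w j ∈ D := by
        simp only [hD, Finset.mem_product, Finset.mem_Ico, Prod.fst_add, Prod.snd_add, e1, e2]
        omega
      refine ih _ ?_ _ hmem rfl
      rw [← ht]
      simp only [hD, Finset.mem_product, Finset.mem_Ico] at hp
      have : 0 ≤ ((N : ℤ) + 1) * p.2 := mul_nonneg (by omega) hp.2.1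
      simp only [Prod.fst_add, Prod.snd_add, e1, e2]
      rw [Int.toNat_lt_toNat]
      · linarith
      · by_contra hcon
        simp only [hD, Finset.mem_product, Finset.mem_Ico, Prod.fst_add, Prod.snd_add, e1, e2]
          at hmem
        have : 0 ≤ ((N : ℤ) + 1) * (p.2 + -∑ j ∈ S, a j) := mul_nonneg (by omega) hmem.2.1
        linarith
  have hle : Submodule.span ℂ (F '' {p : ℤ × ℤ | 0 ≤ p.1 ∧ p.1 < (N : ℤ) ∧ 0 ≤ p.2 ∧
      p.2 < (M : ℤ)}) ≤ W := by
    rw [Submodule.span_le]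
    rintro _ ⟨p, hp, rfl⟩
    refine key _ p ?_ rfl
    simp only [Set.mem_setOf_eq] at hp
    simp only [hD, Finset.mem_product, Finset.mem_Ico]
    tauto
  have hfr : Module.finrank ℂ W ≤ (D \ R).card :=
    (finrank_span_finset_le_card _).trans Finset.card_image_le
  have hmono := (Submodule.finrank_mono hle).trans hfr
  have hcard : ((D \ R).card : ℤ) = N * M - (N - P - P') * (M - A) := by
    rw [Finset.card_sdiff_of_subset hRD, Nat.cast_sub (Finset.card_le_card hRD)]
    simp only [hD, hR, Finset.card_product, Int.card_Ico]
    push_cast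
    rw [Int.toNat_of_nonneg (by omega : 0 ≤ (N : ℤ) - P - P'),
      Int.toNat_of_nonneg (by omega : 0 ≤ (M : ℤ) - A)]
    simp
  have hfin : (Module.finrank ℂ ↥(Submodule.span ℂ (F '' {p : ℤ × ℤ | 0 ≤ p.1 ∧ p.1 < (N : ℤ) ∧
      0 ≤ p.2 ∧ p.2 < (M : ℤ)})) : ℤ) ≤ ((D \ R).card : ℤ) := by exact_mod_cast hmono
  rw [← hPP]
  refine hfin.trans (le_of_eq ?_)
  rw [hcard]
  ring
end

section
/- Let N, M, Q be positive integers, and let (a_q,b_q,c_q,d_q,ω_q), 1 ≤ q ≤ Q, be evanescent-component parameter tuples with b_q > 0 for all q, pairwise distinct in the sense that for all p ≠ q, either (a_p,b_p) ≠ (a_q,b_q) or exp(iω_p) ≠ exp(iω_q). Assume Σ_{q=1}^Q a_q ≤ M and Σ_{q=1}^Q b_q ≤ N. Let F be the stacked column map of the Q tuples, and let L = { (n,m) ∈ D : n > N − 1 − Σ_{q=1}^Q b_q, or m < Σ_{q=1}^Q a_q }. Then the family of vectors { F(n,m) : (n,m) ∈ L } is linearly independent over ℂ. -/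
open Polynomial in
lemma aux_dvd (b : ℕ) (hb : 0 < b) (z : ℂ) (hz : z ≠ 0) (p : ℂ[X])
    (h : ∀ r : ℂ, r ^ b = z → p.eval r = 0) : (X ^ b - C z) ∣ p := by
  by_cases hp : p = 0
  · simp [hp]
  have hsep : (X ^ b - C z : ℂ[X]).Separable :=
    separable_X_pow_sub_C z (by exact_mod_cast hb.ne') hz
  have hs : (X ^ b - C z : ℂ[X]).Splits := IsAlgClosed.splits _
  have hm : (X ^ b - C z : ℂ[X]).Monic := monic_X_pow_sub_C z hb.ne'
  refine (hs.dvd_iff_roots_le_roots hm.ne_zero hp).2 ?_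
  rw [Multiset.le_iff_subset (nodup_roots hsep)]
  intro r hr
  rw [mem_roots hm.ne_zero, IsRoot.def] at hr
  rw [mem_roots hp, IsRoot.def]
  apply h
  simpa [sub_eq_zero] using hr

open Polynomial in
lemma aux_main (Q : ℕ) (a b : Fin Q → ℕ) (z : Fin Q → ℂ) (hz : ∀ q, ‖z q‖ = 1)
    (hb : ∀ q, 0 < b q)
    (hcop : ∀ p q, a p * b q = a q * b p → a p = a q ∧ b p = b q)
    (hd : ∀ p q, p ≠ q → a p = a q → b p = b q → z p ≠ z q)
    (P : ℂ[X][X])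
    (hP : ∀ q, ∀ x y : ℂ, x ≠ 0 → y ≠ 0 → y ^ a q = z q * x ^ b q →
      (P.map (evalRingHom y)).eval x = 0) :
    (∏ q, (X ^ b q - C (C (z q)⁻¹ * X ^ a q))) ∣ P := by
  have hz0 : ∀ q, z q ≠ 0 := fun q h => by have := hz q; simp [h] at this
  set G : ℂ[X][X] := ∏ q, (X ^ b q - C (C (z q)⁻¹ * X ^ a q)) with hG
  have hGm : G.Monic := monic_prod_of_monic _ _ fun q _ => monic_X_pow_sub_C _ (hb q).ne'
  have key : ∀ t : ℝ, 1 < t → G.map (evalRingHom (t : ℂ)) ∣ P.map (evalRingHom (t : ℂ)) := by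
    intro t ht
    have ht0 : (t : ℂ) ≠ 0 := by exact_mod_cast (by linarith : t ≠ 0)
    have e : G.map (evalRingHom (t : ℂ)) = ∏ q, (X ^ b q - C ((z q)⁻¹ * (t : ℂ) ^ a q)) := by
      simp [hG, Polynomial.map_prod]
    rw [e]
    refine Finset.prod_dvd_of_coprime ?_ ?_
    · intro p _ q _ hpq
      change IsCoprime _ _
      rw [isCoprime_iff_aeval_ne_zero_of_isAlgClosed (k := ℂ) ℂ]
      intro r
      by_contra hcon
      push Not at hcon
      obtain ⟨h1, h2⟩ := hcon
      simp [sub_eq_zero] at h1 h2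
      have n1 : ‖r‖ ^ b p = t ^ a p := by
        have := congrArg norm h1
        simpa [hz p, abs_of_pos (by linarith : 0 < t)] using this
      have n2 : ‖r‖ ^ b q = t ^ a q := by
        have := congrArg norm h2
        simpa [hz q, abs_of_pos (by linarith : 0 < t)] using this
      have n3 : t ^ (a p * b q) = t ^ (a q * b p) := by
        rw [pow_mul, pow_mul, ← n1, ← n2, ← pow_mul, ← pow_mul, mul_comm]
      have n4 := pow_right_injective₀ (by linarith : 0 < t) ht.ne' n3
      obtain ⟨e1, e2⟩ := hcop p q n4
      apply hd p q hpq e1 e2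
      rw [e1, e2, h2] at h1
      exact (inv_injective (mul_right_cancel₀ (pow_ne_zero _ ht0) h1)).symm
    · intro q _
      refine aux_dvd _ (hb q) _ (mul_ne_zero (inv_ne_zero (hz0 q)) (pow_ne_zero _ ht0)) _ ?_
      intro r hr
      refine hP q r t ?_ ht0 ?_
      · rintro rfl
        rw [zero_pow (hb q).ne'] at hr
        exact (mul_ne_zero (inv_ne_zero (hz0 q)) (pow_ne_zero _ ht0)) hr.symm
      · rw [hr, mul_inv_cancel_left₀ (hz0 q)]
  rw [← modByMonic_eq_zero_iff_dvd hGm]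
  ext1 n
  rw [coeff_zero]
  apply eq_zero_of_infinite_isRoot
  refine Set.Infinite.mono (s := (fun t : ℝ => (t : ℂ)) '' Set.Ioi 1) ?_
    ((Set.Ioi_infinite 1).image Complex.ofReal_injective.injOn)
  rintro _ ⟨t, ht, rfl⟩
  have h1 := (modByMonic_eq_zero_iff_dvd (hGm.map (evalRingHom (t : ℂ)))).2 (key t ht)
  rw [← map_modByMonic _ hGm] at h1
  have h2 := congrArg (fun f => f.coeff n) h1
  simpa using h2

open Polynomial in
lemma aux_end (Q N : ℕ) (a b : Fin Q → ℕ) (z : Fin Q → ℂ) (hz : ∀ q, z q ≠ 0)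
    (hb : ∀ q, 0 < b q) (P : ℂ[X][X]) (hP : P ≠ 0) (hN : P.natDegree < N)
    (h : (∏ q, (X ^ b q - C (C (z q)⁻¹ * X ^ a q))) ∣ P) :
    ∃ n m, n + ∑ q, b q < N ∧ ∑ q, a q ≤ m ∧ (P.coeff n).coeff m ≠ 0 := by
  obtain ⟨R, hR⟩ := h
  set G : ℂ[X][X] := ∏ q, (X ^ b q - C (C (z q)⁻¹ * X ^ a q)) with hG
  have hGm : G.Monic := monic_prod_of_monic _ _ fun q _ => monic_X_pow_sub_C _ (hb q).ne'
  have hR0 : R ≠ 0 := by rintro rfl; simp at hR; exact hP hR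
  have hdeg : G.natDegree = ∑ q, b q := by
    rw [hG, natDegree_prod_of_monic _ _ fun q _ => monic_X_pow_sub_C _ (hb q).ne']
    exact Finset.sum_congr rfl fun q _ => natDegree_X_pow_sub_C
  have hPd : P.natDegree = G.natDegree + R.natDegree := by
    rw [hR, hGm.natDegree_mul' hR0]
  have hG0 : G.coeff 0 = C (∏ q, -(z q)⁻¹) * X ^ (∑ q, a q) := by
    rw [coeff_zero_eq_eval_zero, hG, eval_prod, map_prod, ← Finset.prod_pow_eq_pow_sum,
      ← Finset.prod_mul_distrib]
    refine Finset.prod_congr rfl fun q _ => ?_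
    simp [(hb q).ne']
  have hc : (∏ q, -(z q)⁻¹) ≠ 0 :=
    Finset.prod_ne_zero_iff.2 fun q _ => neg_ne_zero.2 (inv_ne_zero (hz q))
  have hG00 : G.coeff 0 ≠ 0 := by
    rw [hG0]; exact mul_ne_zero (C_ne_zero.2 hc) (pow_ne_zero _ X_ne_zero)
  have hGt : G.natTrailingDegree = 0 := natTrailingDegree_eq_zero.2 (Or.inr hG00)
  have hco : P.coeff R.natTrailingDegree = G.coeff 0 * R.trailingCoeff := by
    have := coeff_mul_natTrailingDegree_add_natTrailingDegree (p := G) (q := R)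
    rw [hGt, zero_add, ← hR] at this
    rw [this, trailingCoeff, hGt]
  have hT : R.trailingCoeff ≠ 0 := trailingCoeff_nonzero_iff_nonzero.2 hR0
  refine ⟨R.natTrailingDegree, R.trailingCoeff.natDegree + ∑ q, a q, ?_, by omega, ?_⟩
  · have := natTrailingDegree_le_natDegree R
    omega
  · rw [hco, hG0, mul_assoc, mul_comm (X ^ _), coeff_C_mul, coeff_mul_X_pow]
    exact mul_ne_zero hc (leadingCoeff_ne_zero.2 hT)

lemma aux_eval (Q : ℕ) (a b c d : Fin Q → ℤ) (ω : Fin Q → ℝ) (q : Fin Q)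
    (hdet : a q * d q - b q * c q = 1) {ι : Type*} (s : Finset ι) (f : ι → ℤ × ℤ) (g : ι → ℂ)
    (hg : ∑ i ∈ s, g i • stackedColumnMap Q a b c d ω (f i) = 0)
    (x y : ℂ) (hx : x ≠ 0) (hy : y ≠ 0)
    (hxy : y ^ a q = Complex.exp (Complex.I * (ω q : ℂ)) * x ^ b q) :
    ∑ i ∈ s, g i * (x ^ (f i).1 * y ^ (f i).2) = 0 := by
  classical
  set K : ι → ℤ := fun i => (f i).1 * a q + (f i).2 * b q with hK
  have h1 : ∀ i ∈ s, g i * (x ^ (f i).1 * y ^ (f i).2) =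
      ∑ k ∈ s.image K, (x ^ d q * y ^ (-c q)) ^ k *
        (g i * stackedColumnMap Q a b c d ω (f i) (q, k)) := by
    intro i hi
    rw [Finset.sum_eq_single_of_mem (K i) (Finset.mem_image_of_mem _ hi)]
    · have e : Complex.exp (Complex.I * (ω q : ℂ) *
          (((f i).1 : ℂ) * (c q : ℂ) + ((f i).2 : ℂ) * (d q : ℂ))) =
          (y ^ a q * x ^ (-b q)) ^ ((f i).1 * c q + (f i).2 * d q) := by
        rw [hxy, mul_assoc (Complex.exp (Complex.I * (ω q : ℂ))), ← zpow_add₀ hx, add_neg_cancel, zpow_zero, mul_one,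
          ← Complex.exp_int_mul]
        congr 1
        push_cast
        ring
      simp only [stackedColumnMap, hK, if_true]
      rw [e, mul_zpow, mul_zpow, ← zpow_mul, ← zpow_mul, ← zpow_mul, ← zpow_mul]
      have ex : x ^ (f i).1 = x ^ (d q * ((f i).1 * a q + (f i).2 * b q)) *
          x ^ (-b q * ((f i).1 * c q + (f i).2 * d q)) := by
        rw [← zpow_add₀ hx]; congr 1; linear_combination (-(f i).1) * hdet
      have ey : y ^ (f i).2 = y ^ (-c q * ((f i).1 * a q + (f i).2 * b q)) *
          y ^ (a q * ((f i).1 * c q + (f i).2 * d q)) := by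
        rw [← zpow_add₀ hy]; congr 1; linear_combination (-(f i).2) * hdet
      rw [ex, ey]; ring
    · intro k _ hk
      have : ¬ ((f i).1 * a q + (f i).2 * b q = k) := fun h => hk h.symm
      simp [stackedColumnMap, this]
  rw [Finset.sum_congr rfl h1, Finset.sum_comm]
  refine Finset.sum_eq_zero fun k _ => ?_
  rw [← Finset.mul_sum]
  have := congrFun hg (q, k)
  simp only [Finset.sum_apply, Pi.smul_apply, smul_eq_mul, Pi.zero_apply] at this
  rw [this, mul_zero]

theorem stacked_columns_linearIndependent_on_L
    (N M Q : ℕ) (hN : 0 < N) (hM : 0 < M) (hQ : 0 < Q)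
    (a b c d : Fin Q → ℤ) (ω : Fin Q → ℝ)
    (ha : ∀ q, 0 ≤ a q) (hb : ∀ q, 0 < b q)
    (hdet : ∀ q, a q * d q - b q * c q = 1)
    (hdistinct : ∀ p q : Fin Q, p ≠ q →
      (a p, b p) ≠ (a q, b q) ∨
      Complex.exp (Complex.I * (ω p : ℂ)) ≠ Complex.exp (Complex.I * (ω q : ℂ)))
    (hsum_a : (∑ q, a q) ≤ (M : ℤ)) (hsum_b : (∑ q, b q) ≤ (N : ℤ))
    (L : Set (ℤ × ℤ))
    (hL : L = {p : ℤ × ℤ | (0 ≤ p.1 ∧ p.1 < (N : ℤ) ∧ 0 ≤ p.2 ∧ p.2 < (M : ℤ)) ∧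
      ((N : ℤ) - 1 - (∑ q, b q) < p.1 ∨ p.2 < (∑ q, a q))}) :
    LinearIndependent ℂ (fun x : L => stackedColumnMap Q a b c d ω (x : ℤ × ℤ)) := by
  classical
  subst hL
  lift a to Fin Q → ℕ using ha
  lift b to Fin Q → ℕ using (fun q => (hb q).le)
  rw [linearIndependent_iff']
  intro s g hg
  set z : Fin Q → ℂ := fun q => Complex.exp (Complex.I * (ω q : ℂ)) with hzdef
  have hz : ∀ q, ‖z q‖ = 1 := fun q => by
    rw [hzdef]; simp only; rw [mul_comm]; exact Complex.norm_exp_ofReal_mul_I _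
  have hz0 : ∀ q, z q ≠ 0 := fun q => Complex.exp_ne_zero _
  have hb' : ∀ q, 0 < b q := fun q => Int.natCast_pos.1 (hb q)
  set P : Polynomial (Polynomial ℂ) := ∑ i ∈ s,
    Polynomial.monomial i.1.1.toNat (Polynomial.monomial i.1.2.toNat (g i)) with hPdef
  have hcoef : ∀ n m, (P.coeff n).coeff m =
      ∑ i ∈ s, if i.1.1.toNat = n ∧ i.1.2.toNat = m then g i else 0 := by
    intro n m
    rw [hPdef, Polynomial.finsetSum_coeff, Polynomial.finsetSum_coeff]
    refine Finset.sum_congr rfl fun i _ => ?_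
    rw [Polynomial.coeff_monomial]
    by_cases h : i.1.1.toNat = n <;> simp [h, Polynomial.coeff_monomial]
  have hP0 : P = 0 := by
    by_contra hP
    have hdeg : P.natDegree < N := by
      rw [Polynomial.natDegree_lt_iff_degree_lt hP, Polynomial.degree_lt_iff_coeff_zero]
      intro n hn
      ext1 m
      rw [hcoef, Polynomial.coeff_zero]
      refine Finset.sum_eq_zero fun i _ => if_neg ?_
      rintro ⟨h1, -⟩
      have := i.2.1
      have hn' : N ≤ n := hn
      omega
    obtain ⟨n, m, h1, h2, h3⟩ := aux_end Q N a b z hz0 hb' P hP hdeg (by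
      refine aux_main Q a b z hz hb' ?_ ?_ P ?_
      · intro p q h
        have hZ : (a p : ℤ) * b q = a q * b p := by exact_mod_cast h
        have hp := hdet p
        have hq := hdet q
        have d1 : (b p : ℤ) ∣ b q := ⟨a q * d p - b q * c p, by
          linear_combination (-(b q : ℤ)) * hp + d p * hZ⟩
        have d2 : (b q : ℤ) ∣ b p := ⟨a p * d q - b p * c q, by
          linear_combination (-(b p : ℤ)) * hq - d q * hZ⟩
        have e : b p = b q := Nat.dvd_antisymm (by exact_mod_cast d1) (by exact_mod_cast d2)
        rw [e] at h
        exact ⟨Nat.eq_of_mul_eq_mul_right (hb' q) h, e⟩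
      · intro p q hpq h1 h2
        rcases hdistinct p q hpq with h | h
        · simp [h1, h2] at h
        · exact h
      · intro q x y hx hy hxy
        have := aux_eval Q (fun q => (a q : ℤ)) (fun q => (b q : ℤ)) c d ω q (hdet q) s
          (fun i => (i : ℤ × ℤ)) g hg x y hx hy (by simpa using hxy)
        rw [hPdef, Polynomial.map_sum, Polynomial.eval_finsetSum, ← this]
        refine Finset.sum_congr rfl fun i _ => ?_
        have hi := i.2.1
        have e1 : x ^ (i.1.1) = x ^ (i.1.1.toNat) := by
          rw [← zpow_natCast, Int.toNat_of_nonneg hi.1]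
        have e2 : y ^ (i.1.2) = y ^ (i.1.2.toNat) := by
          rw [← zpow_natCast, Int.toNat_of_nonneg hi.2.2.1]
        rw [e1, e2]
        simp [Polynomial.map_monomial, Polynomial.eval_monomial]
        ring)
    apply h3
    rw [hcoef]
    refine Finset.sum_eq_zero fun i _ => if_neg ?_
    rintro ⟨k1, k2⟩
    obtain ⟨⟨p1, p2⟩, hi⟩ := i
    simp only [Set.mem_ofPred_eq] at hi k1 k2
    have s1 : (∑ q, (b q : ℤ)) = ((∑ q, b q : ℕ) : ℤ) := by push_cast; rfl
    have s2 : (∑ q, (a q : ℤ)) = ((∑ q, a q : ℕ) : ℤ) := by push_cast; rfl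
    rw [s1, s2] at hi
    omega
  intro i hi
  have h := hcoef i.1.1.toNat i.1.2.toNat
  rw [hP0, Finset.sum_eq_single_of_mem i hi] at h
  · simpa using h.symm
  · intro j _ hji
    refine if_neg ?_
    rintro ⟨k1, k2⟩
    apply hji
    have hi := i.2.1
    have hj := j.2.1
    refine Subtype.ext (Prod.ext ?_ ?_) <;> omega
end
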